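/- arXiv:1001.4122 — 3 statements merged into one kernel-verified Lean document; each statement's English description precedes it below -/
import Mathlib

section
/- For a finite simple undirected graph G with adjacency matrix A, the i-th diagonal entry of A^4 satisfies (A^4)_{ii} = 2 Q_i + (deg v_i)^2 + Σ_{j ∈ N_i} (deg v_j − 1), where the sum is over the neighbors of v_i. -/
open Finset

/-- The number of quadrangles (cycles of length 4) of `G` containing the vertex `i`:
a quadrangle through `i` is uniquely encoded by a triple `(a, j, b)` with `a < b`, where
`(i, a, j, b, i)` is a closed walk of length 4 whose vertices `i, a, j, b` are distinct. -/
def quadrangleCount {V : Type*} [Fintype V] [LinearOrder V]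
    (G : SimpleGraph V) [DecidableRel G.Adj] (i : V) : ℕ :=
  (Finset.univ.filter fun t : V × V × V =>
    G.Adj i t.1 ∧ G.Adj t.1 t.2.1 ∧ G.Adj t.2.1 t.2.2 ∧ G.Adj t.2.2 i ∧
      t.2.1 ≠ i ∧ t.1 < t.2.2).card

/-- The diagonal entry `(A ^ 4) i i` counts the closed walks `(i, a, j, b, i)`. -/
theorem adjMatrix_pow_four_diag_eq_sum {V : Type*} [Fintype V] [DecidableEq V]
    (G : SimpleGraph V) [DecidableRel G.Adj] (i : V) :
    (G.adjMatrix ℕ ^ 4) i i =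
      ∑ a, ∑ j, ∑ b, if G.Adj i a ∧ G.Adj a j ∧ G.Adj j b ∧ G.Adj b i then 1 else 0 := by
  have h : G.adjMatrix ℕ ^ 4 =
      G.adjMatrix ℕ * (G.adjMatrix ℕ * (G.adjMatrix ℕ * G.adjMatrix ℕ)) := by
    simp only [pow_succ, pow_zero, one_mul, mul_assoc]
  simp only [h, Matrix.mul_apply, Finset.mul_sum, SimpleGraph.adjMatrix_apply, ite_and, ite_mul,
    one_mul, zero_mul]

theorem quadrangleCount_eq_sum {V : Type*} [Fintype V] [LinearOrder V]
    (G : SimpleGraph V) [DecidableRel G.Adj] (i : V) :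
    quadrangleCount G i = ∑ a, ∑ j, ∑ b,
      if G.Adj i a ∧ G.Adj a j ∧ G.Adj j b ∧ G.Adj b i ∧ j ≠ i ∧ a < b then 1 else 0 := by
  simp only [quadrangleCount, Finset.card_filter, Fintype.sum_prod_type]

/-- Reversing the closed walk `(i, a, j, b, i)` exchanges `a` and `b`. -/
theorem quadrangleCount_eq_sum_swap {V : Type*} [Fintype V] [LinearOrder V]
    (G : SimpleGraph V) [DecidableRel G.Adj] (i : V) :
    quadrangleCount G i = ∑ a, ∑ j, ∑ b,
      if G.Adj i a ∧ G.Adj a j ∧ G.Adj j b ∧ G.Adj b i ∧ j ≠ i ∧ b < a then 1 else 0 := by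
  rw [quadrangleCount_eq_sum, Finset.sum_comm]
  conv_rhs => rw [Finset.sum_comm]
  refine Finset.sum_congr rfl fun j _ => ?_
  rw [Finset.sum_comm]
  refine Finset.sum_congr rfl fun a _ => Finset.sum_congr rfl fun b _ => ?_
  simp only [G.adj_comm i, G.adj_comm j]
  congr 1
  grind

/-- The closed walks `(i, a, i, b, i)` correspond to ordered pairs of neighbors of `i`. -/
theorem sum_walks_returning {V : Type*} [Fintype V] [DecidableEq V]
    (G : SimpleGraph V) [DecidableRel G.Adj] (i : V) :
    (∑ a, ∑ j, ∑ b,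
      if G.Adj i a ∧ G.Adj a j ∧ G.Adj j b ∧ G.Adj b i ∧ j = i then 1 else 0) =
      G.degree i ^ 2 := by
  have h (a j b : V) : (if G.Adj i a ∧ G.Adj a j ∧ G.Adj j b ∧ G.Adj b i ∧ j = i then 1 else 0) =
      if j = i then (if G.Adj i a then 1 else 0) * (if G.Adj i b then 1 else 0) else 0 := by
    have := G.adj_comm i a
    have := G.adj_comm i b
    grind
  rw [← G.card_neighborFinset_eq_degree, G.neighborFinset_eq_filter, Finset.card_filter, sq,
    Finset.sum_mul_sum]
  refine Finset.sum_congr rfl fun a _ => ?_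
  rw [Finset.sum_comm]
  simp only [h, Finset.sum_ite_eq', Finset.mem_univ, if_true]

/-- The closed walks `(i, a, j, a, i)` with `j ≠ i` correspond to paths of length 2 from `i`. -/
theorem sum_walks_retracing {V : Type*} [Fintype V] [DecidableEq V]
    (G : SimpleGraph V) [DecidableRel G.Adj] (i : V) :
    (∑ a, ∑ j, ∑ b,
      if G.Adj i a ∧ G.Adj a j ∧ G.Adj j b ∧ G.Adj b i ∧ j ≠ i ∧ a = b then 1 else 0) =
      ∑ a ∈ G.neighborFinset i, (G.degree a - 1) := by
  have h (a j b : V) :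
      (if G.Adj i a ∧ G.Adj a j ∧ G.Adj j b ∧ G.Adj b i ∧ j ≠ i ∧ a = b then 1 else 0) =
        if a = b then (if G.Adj i a ∧ G.Adj a j ∧ j ≠ i then 1 else 0) else 0 := by
    have := G.adj_comm i a
    have := G.adj_comm a j
    grind
  simp only [h, Finset.sum_ite_eq, Finset.mem_univ, if_true]
  rw [G.neighborFinset_eq_filter, Finset.sum_filter]
  refine Finset.sum_congr rfl fun a _ => ?_
  split_ifs with ha
  · have hi : i ∈ G.neighborFinset a := (G.mem_neighborFinset a i).2 ha.symm
    rw [← G.card_neighborFinset_eq_degree, ← Finset.card_erase_of_mem hi, ← Finset.card_filter]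
    congr 1
    ext j
    simp [ha, and_comm]
  · simp [ha]

/-- For a finite simple graph `G` with adjacency matrix `A`,
`(A^4)_{ii} = 2 Q_i + (deg v_i)^2 + Σ_{j ∈ N_i} (deg v_j − 1)`, where `Q_i` is the number of
quadrangles of `G` containing vertex `i` and `N_i` is the neighborhood of `i`. -/
theorem adjMatrix_pow_four_diag
    {V : Type*} [Fintype V] [LinearOrder V] (G : SimpleGraph V) [DecidableRel G.Adj]
    (i : V) :
    (G.adjMatrix ℕ ^ 4) i i =
      2 * quadrangleCount G i + (G.degree i) ^ 2 +
        ∑ j ∈ G.neighborFinset i, (G.degree j - 1) := by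
  rw [two_mul]
  nth_rw 1 [quadrangleCount_eq_sum]
  rw [quadrangleCount_eq_sum_swap, adjMatrix_pow_four_diag_eq_sum, ← sum_walks_returning,
    ← sum_walks_retracing]
  simp only [← Finset.sum_add_distrib]
  refine Finset.sum_congr rfl fun a _ => Finset.sum_congr rfl fun j _ =>
    Finset.sum_congr rfl fun b _ => ?_
  by_cases hw : G.Adj i a ∧ G.Adj a j ∧ G.Adj j b ∧ G.Adj b i
  · obtain ⟨h₁, h₂, h₃, h₄⟩ := hw
    by_cases hj : j = i
    · simp_all
    · rcases lt_trichotomy a b with hab | rfl | hab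
      · simp [*, hab.ne, hab.not_gt]
      · simp [*]
      · simp [*, hab.ne', hab.not_gt]
  · grind
end

section
/- For a finite simple undirected graph G on n vertices with Laplacian matrix L having eigenvalues λ_1 ≤ … ≤ λ_n, the fourth spectral moment satisfies m_4(L) = (1/n) Σ_{i=1}^n λ_i^4 = (1/n) Σ_{i=1}^n [ (deg v_i)^4 + 4 (deg v_i)^3 + (deg v_i)^2 − deg v_i + (2 deg v_i + 1) Σ_{j ∈ N_i} deg v_j − 8 T_i deg v_i + 2 Q_i ]. -/
open Finset

/-- The number of triangles of `G` containing the vertex `i`: the number of unordered pairs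
`{u, w}` of neighbors of `i` with `u` adjacent to `w`. -/
def triangleCount {V : Type*} [Fintype V] [LinearOrder V]
    (G : SimpleGraph V) [DecidableRel G.Adj] (i : V) : ℕ :=
  (Finset.univ.filter fun p : V × V =>
    G.Adj i p.1 ∧ G.Adj i p.2 ∧ G.Adj p.1 p.2 ∧ p.1 < p.2).card

namespace Matrix

/-- The trace of a power of a Hermitian matrix is the corresponding power sum of its
eigenvalues. -/
lemma IsHermitian.trace_pow_eq_sum_eigenvalues_pow {m 𝕜 : Type*} [Fintype m] [DecidableEq m]
    [RCLike 𝕜] {A : Matrix m m 𝕜} (hA : A.IsHermitian) (k : ℕ) :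
    (A ^ k).trace = ∑ i, (hA.eigenvalues i : 𝕜) ^ k := by
  conv_lhs => rw [hA.spectral_theorem, ← map_pow, Unitary.conjStarAlgAut_apply,
    trace_mul_cycle, Unitary.coe_star_mul_self, one_mul, diagonal_pow, trace_diagonal]
  simp

lemma trace_sub_pow_four {m R : Type*} [Fintype m] [DecidableEq m] [CommRing R]
    (D A : Matrix m m R) :
    ((D - A) ^ 4).trace = (D ^ 4).trace - 4 * (D ^ 3 * A).trace + 4 * (D ^ 2 * A ^ 2).trace
      + 2 * (D * A * D * A).trace - 4 * (D * A ^ 3).trace + (A ^ 4).trace := by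
  have cycle (a b c d : Matrix m m R) : (a * b * c * d).trace = (d * a * b * c).trace := by
    rw [trace_mul_comm, mul_assoc d a b, mul_assoc d (a * b) c]
  simp only [pow_succ, pow_zero, one_mul, mul_sub, sub_mul, trace_sub, ← mul_assoc]
  linear_combination -cycle A D D D - 2 * cycle D A D D - 3 * cycle D D A D
    + cycle A D D A + 2 * cycle A A D D + 3 * cycle D A A D + cycle A D A D
    - cycle A D A A - 2 * cycle A A D A - 3 * cycle A A A D

end Matrix

lemma Finset.sum_sum_eq_two_mul_sum_lt_add_sum_diag {α R : Type*} [Fintype α] [LinearOrder α]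
    [CommRing R] (f : α → α → R) (hf : ∀ x y, f x y = f y x) :
    ∑ x, ∑ y, f x y = 2 * ∑ x, ∑ y, (if x < y then f x y else 0) + ∑ x, f x x := by
  have hgt : ∑ x, ∑ y, (if y < x then f x y else 0) = ∑ x, ∑ y, (if x < y then f x y else 0) := by
    rw [Finset.sum_comm]
    exact Finset.sum_congr rfl fun x _ => Finset.sum_congr rfl fun y _ => by rw [hf]
  have hdiag : ∑ x, f x x = ∑ x, ∑ y, (if x = y then f x y else 0) := by simp
  rw [two_mul]
  nth_rw 2 [← hgt]
  rw [hdiag]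
  simp only [← Finset.sum_add_distrib]
  refine Finset.sum_congr rfl fun x _ => Finset.sum_congr rfl fun y _ => ?_
  rcases lt_trichotomy x y with h | h | h
  · simp [h, h.not_gt, h.ne]
  · simp [h]
  · simp [h, h.not_gt, h.ne']

namespace SimpleGraph

variable {V : Type*} [Fintype V] [LinearOrder V] (G : SimpleGraph V) [DecidableRel G.Adj]
  (R : Type*) [CommRing R]

lemma adjMatrix_pow_two_apply_self (i : V) : (G.adjMatrix R ^ 2) i i = G.degree i := by
  rw [sq, adjMatrix_mul_self_apply_self]

lemma adjMatrix_pow_three_apply_self (i : V) :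
    (G.adjMatrix R ^ 3) i i = 2 * triangleCount G i := by
  have h : (G.adjMatrix R ^ 3) i i =
      ∑ x, ∑ y, if G.Adj i x ∧ G.Adj i y ∧ G.Adj x y then (1 : R) else 0 := by
    rw [pow_succ', sq, Matrix.mul_apply]
    simp only [Matrix.mul_apply, adjMatrix_apply, Finset.mul_sum]
    refine Finset.sum_congr rfl fun x _ => Finset.sum_congr rfl fun y _ => ?_
    by_cases h1 : G.Adj i x <;> by_cases h2 : G.Adj i y <;> by_cases h3 : G.Adj x y <;>
      simp [h1, h2, h3, G.adj_comm y i]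
  rw [h, Finset.sum_sum_eq_two_mul_sum_lt_add_sum_diag _ fun x y => ?_]
  · rw [triangleCount, Finset.natCast_card_filter, Fintype.sum_prod_type]
    simp only [SimpleGraph.irrefl, and_false, if_false, Finset.sum_const_zero, add_zero,
      ← ite_and]
    congr 1
    refine Finset.sum_congr rfl fun x _ => Finset.sum_congr rfl fun y _ => ?_
    congr 1
    exact propext (by tauto)
  · congr 1
    rw [G.adj_comm x y]
    exact propext (by tauto)

lemma adjMatrix_pow_four_apply_self (i : V) :
    (G.adjMatrix R ^ 4) i i = 2 * quadrangleCount G i + (G.degree i : R) ^ 2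
      + ∑ j ∈ G.neighborFinset i, (G.degree j : R) - G.degree i := by
  set a : V → V → R := G.adjMatrix R with ha
  have symm (x y : V) : a x y = a y x := by simp [ha, G.adj_comm]
  have idem (x y : V) : a x y * a x y = a x y := by
    by_cases h : G.Adj x y <;> simp [ha, h]
  have deg (x : V) : ∑ y, a x y = G.degree x := by
    simp [ha, ← G.neighborFinset_eq_filter]
  have h4 : (G.adjMatrix R ^ 4) i i = ∑ x, ∑ y, a i x * a i y * ∑ j, a x j * a y j := by
    have hpow : G.adjMatrix R ^ 4 =
        G.adjMatrix R * (G.adjMatrix R * G.adjMatrix R * G.adjMatrix R) := by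
      noncomm_ring
    rw [hpow, Matrix.mul_apply]
    refine Finset.sum_congr rfl fun x _ => ?_
    rw [Matrix.mul_apply, Finset.mul_sum]
    refine Finset.sum_congr rfl fun y _ => ?_
    rw [Matrix.mul_apply]
    change a i x * ((∑ j, a x j * a j y) * a y i) = _
    simp only [symm _ y]
    rw [symm y i]
    ring
  have split (x y : V) : a i x * a i y * ∑ j, a x j * a y j =
      a i x * a i y + a i x * a i y * ∑ j, if j = i then 0 else a x j * a y j := by
    have : ∑ j, a x j * a y j =
        a x i * a y i + ∑ j, if j = i then 0 else a x j * a y j := by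
      rw [← Finset.add_sum_erase _ _ (Finset.mem_univ i),
        ← Finset.add_sum_erase _ (fun j => if j = i then 0 else a x j * a y j)
          (Finset.mem_univ i), if_pos rfl, zero_add]
      congr 1
      exact Finset.sum_congr rfl fun j hj => by rw [if_neg (Finset.ne_of_mem_erase hj)]
    rw [this, symm x i, symm y i]
    linear_combination (a i y * a i y) * idem i x + a i x * idem i y
  have diag : ∑ x, a i x * a i x * (∑ j, if j = i then 0 else a x j * a x j) =
      ∑ j ∈ G.neighborFinset i, (G.degree j : R) - G.degree i := by
    have inner (x : V) : (∑ j, if j = i then 0 else a x j * a x j) = G.degree x - a x i := by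
      rw [← deg x, eq_sub_iff_add_eq, ← Finset.add_sum_erase _ _ (Finset.mem_univ i),
        ← Finset.add_sum_erase _ (a x) (Finset.mem_univ i), if_pos rfl, zero_add, add_comm]
      congr 1
      exact Finset.sum_congr rfl fun j hj => by rw [if_neg (Finset.ne_of_mem_erase hj), idem]
    have term (x : V) : a i x * a i x * (∑ j, if j = i then 0 else a x j * a x j) =
        a i x * G.degree x - a i x := by
      rw [inner, symm x i]
      linear_combination (G.degree x - a i x - 1 : R) * idem i x
    rw [Finset.sum_congr rfl fun x _ => term x, Finset.sum_sub_distrib, deg]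
    congr 1
    simp [ha, neighborFinset_eq_filter, Finset.sum_filter]
  have quad : ∑ x, ∑ y, (if x < y then
      a i x * a i y * (∑ j, if j = i then 0 else a x j * a y j) else 0) =
      (quadrangleCount G i : R) := by
    rw [quadrangleCount, Finset.natCast_card_filter]
    simp only [Fintype.sum_prod_type]
    refine Finset.sum_congr rfl fun x _ => ?_
    rw [Finset.sum_comm (s := Finset.univ) (t := Finset.univ)]
    refine Finset.sum_congr rfl fun y _ => ?_
    split_ifs with hxy
    · rw [Finset.mul_sum]
      refine Finset.sum_congr rfl fun j _ => ?_
      by_cases h1 : G.Adj i x <;> by_cases h2 : G.Adj i y <;> by_cases h3 : G.Adj x j <;>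
        by_cases h4 : G.Adj y j <;> by_cases h5 : j = i <;>
        simp [ha, h1, h2, h3, h4, h5, hxy, G.adj_comm y i, G.adj_comm j y]
    · simp [hxy]
  rw [h4]
  simp only [split, Finset.sum_add_distrib]
  rw [Finset.sum_sum_eq_two_mul_sum_lt_add_sum_diag
    (fun x y => a i x * a i y * ∑ j, if j = i then 0 else a x j * a y j) fun x y => ?_,
    diag, quad]
  · rw [← Finset.sum_mul_sum, deg]
    ring
  · simp only [mul_comm]

lemma trace_lapMatrix_pow_four :
    (G.lapMatrix R ^ 4).trace = ∑ i,
      ((G.degree i : R) ^ 4 + 4 * (G.degree i : R) ^ 3 + (G.degree i : R) ^ 2 - G.degree i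
        + (2 * G.degree i + 1) * ∑ j ∈ G.neighborFinset i, (G.degree j : R)
        - 8 * triangleCount G i * G.degree i + 2 * quadrangleCount G i) := by
  rw [lapMatrix, Matrix.trace_sub_pow_four]
  have hDADA : (G.degMatrix R * G.adjMatrix R * G.degMatrix R * G.adjMatrix R).trace =
      ∑ i, (G.degree i : R) * ∑ j ∈ G.neighborFinset i, (G.degree j : R) := by
    refine Finset.sum_congr rfl fun i _ => ?_
    rw [Matrix.diag_apply, Matrix.mul_assoc, Matrix.mul_apply, neighborFinset_eq_filter,
      Finset.sum_filter, Finset.mul_sum]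
    refine Finset.sum_congr rfl fun j _ => ?_
    rw [degMatrix, Matrix.diagonal_mul, Matrix.diagonal_mul]
    by_cases h : G.Adj i j <;> simp [h, G.adj_comm j i]
  rw [hDADA]
  simp only [degMatrix, Matrix.diagonal_pow, Matrix.trace, Matrix.diag_apply,
    Matrix.diagonal_mul, Matrix.diagonal_apply_eq, Pi.pow_apply, adjMatrix_pow_two_apply_self,
    adjMatrix_pow_three_apply_self, adjMatrix_pow_four_apply_self, adjMatrix_apply,
    SimpleGraph.irrefl, if_false, mul_zero, Finset.sum_const_zero, sub_zero,
    Finset.mul_sum (s := Finset.univ), ← Finset.sum_add_distrib, ← Finset.sum_sub_distrib]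
  exact Finset.sum_congr rfl fun i _ => by ring

end SimpleGraph

/-- Fourth spectral moment of the Laplacian: for a finite simple graph `G` on `n` vertices with
Laplacian eigenvalues `λ₁ ≤ … ≤ λₙ`,
`(1/n) Σᵢ λᵢ⁴ = (1/n) Σᵢ [(deg vᵢ)⁴ + 4(deg vᵢ)³ + (deg vᵢ)² − deg vᵢ
  + (2 deg vᵢ + 1) Σ_{j ∈ Nᵢ} deg vⱼ − 8 Tᵢ deg vᵢ + 2 Qᵢ]`. -/
theorem fourth_spectral_moment_lapMatrix
    {n : ℕ} (hn : 0 < n) (G : SimpleGraph (Fin n)) [DecidableRel G.Adj]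
    (hL : (G.lapMatrix ℝ).IsHermitian) :
    (1 / n : ℝ) * ∑ i, hL.eigenvalues i ^ 4 =
      (1 / n : ℝ) * ∑ i,
        ((G.degree i : ℝ) ^ 4 + 4 * (G.degree i : ℝ) ^ 3 + (G.degree i : ℝ) ^ 2
          - (G.degree i : ℝ)
          + (2 * (G.degree i : ℝ) + 1) * ∑ j ∈ G.neighborFinset i, (G.degree j : ℝ)
          - 8 * (triangleCount G i : ℝ) * (G.degree i : ℝ)
          + 2 * (quadrangleCount G i : ℝ)) := by
  rw [← G.trace_lapMatrix_pow_four ℝ, hL.trace_pow_eq_sum_eigenvalues_pow]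
  rfl
end

section
/- Let G be a finite simple undirected graph on n vertices and let F : ℝ^n → ℝ^n be the one-step maximum-consensus map defined componentwise by (F x)_i = max over j in the closed neighborhood of v_i (i.e., j = i or v_j adjacent to v_i) of x_j. Then for every initial state x ∈ ℝ^n, the n-fold iterate satisfies (F^n x)_i = max { x_j : v_j is in the same connected component of G as v_i }. Consequently, two vertices v_i and v_k satisfy (F^n x)_i = (F^n x)_k for all initial states x if and only if v_i and v_k belong to the same connected component of G. -/
open Finset

section MaxConsensus

variable {V α : Type*} [Fintype V] [DecidableEq V] [LinearOrder α]
  {G : SimpleGraph V} [DecidableRel G.Adj] {F : (V → α) → V → α}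

theorem exists_reachable_iterate_eq
    (hF : ∀ x i, F x i = (insert i (G.neighborFinset i)).sup' (Finset.insert_nonempty i _) x)
    (x : V → α) (m : ℕ) (i : V) : ∃ j, G.Reachable i j ∧ F^[m] x i = x j := by
  induction m generalizing i with
  | zero => exact ⟨i, .refl i, rfl⟩
  | succ m ih =>
    rw [Function.iterate_succ_apply', hF]
    obtain ⟨k, hk, hmax⟩ := Finset.exists_mem_eq_sup' (Finset.insert_nonempty i
      (G.neighborFinset i)) (F^[m] x)
    obtain ⟨j, hj, hkj⟩ := ih k
    refine ⟨j, ?_, hmax.trans hkj⟩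
    rcases Finset.mem_insert.mp hk with rfl | hadj
    · exact hj
    · exact ((G.mem_neighborFinset i k).mp hadj).reachable.trans hj

theorem le_iterate_of_walk_length_le
    (hF : ∀ x i, F x i = (insert i (G.neighborFinset i)).sup' (Finset.insert_nonempty i _) x)
    (x : V → α) {m : ℕ} {i j : V} (p : G.Walk i j) (hp : p.length ≤ m) : x j ≤ F^[m] x i := by
  induction m generalizing i with
  | zero =>
    obtain rfl := SimpleGraph.Walk.eq_of_length_eq_zero (Nat.le_zero.mp hp)
    exact le_rfl
  | succ m ih =>
    rw [Function.iterate_succ_apply', hF]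
    cases p with
    | nil =>
      exact (ih .nil (Nat.zero_le m)).trans
        (Finset.le_sup' (F^[m] x) (Finset.mem_insert_self _ _))
    | cons h q =>
      exact (ih q (Nat.le_of_succ_le_succ hp)).trans
        (Finset.le_sup' (F^[m] x)
          (Finset.mem_insert_of_mem ((G.mem_neighborFinset _ _).mpr h)))

theorem le_iterate_card_of_reachable
    (hF : ∀ x i, F x i = (insert i (G.neighborFinset i)).sup' (Finset.insert_nonempty i _) x)
    (x : V → α) {i j : V} (h : G.Reachable i j) : x j ≤ F^[Fintype.card V] x i := by
  obtain ⟨p, hp⟩ := h.exists_isPath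
  exact le_iterate_of_walk_length_le hF x p hp.length_lt.le

end MaxConsensus

/-- Let `F` be the one-step maximum-consensus map of a finite simple graph `G` on `n`
vertices: `(F x) i` is the maximum of `x` over the closed neighborhood of `vᵢ`. Then for
every initial state `x`, the `n`-fold iterate `F^[n] x` at `i` equals the maximum of `x`
over the connected component of `vᵢ`; consequently, `(F^[n] x) i = (F^[n] x) k` holds for
all initial states `x` if and only if `vᵢ` and `vₖ` lie in the same connected component. -/
theorem max_consensus_iterate
    {n : ℕ} (G : SimpleGraph (Fin n)) [DecidableRel G.Adj]
    (F : (Fin n → ℝ) → (Fin n → ℝ))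
    (hF : ∀ (x : Fin n → ℝ) (i : Fin n),
      F x i = (insert i (G.neighborFinset i)).sup' (Finset.insert_nonempty i _) x) :
    (∀ (x : Fin n → ℝ) (i : Fin n),
        F^[n] x i =
          (Finset.univ.filter fun j => G.Reachable i j).sup'
            ⟨i, Finset.mem_filter.mpr ⟨Finset.mem_univ i, SimpleGraph.Reachable.refl i⟩⟩ x) ∧
    (∀ i k : Fin n,
        (∀ x : Fin n → ℝ, F^[n] x i = F^[n] x k) ↔ G.Reachable i k) := by
  have hle (x : Fin n → ℝ) {i j : Fin n} (h : G.Reachable i j) : x j ≤ F^[n] x i := by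
    simpa using le_iterate_card_of_reachable hF x h
  have hex := fun x i => exists_reachable_iterate_eq hF x n i
  refine ⟨fun x i => le_antisymm ?_ ?_, fun i k => ⟨fun h => ?_, fun h x => le_antisymm ?_ ?_⟩⟩
  · obtain ⟨j, hj, hij⟩ := hex x i
    rw [hij]
    exact Finset.le_sup' x (Finset.mem_filter.mpr ⟨Finset.mem_univ j, hj⟩)
  · exact Finset.sup'_le _ _ fun j hj => hle x (Finset.mem_filter.mp hj).2
  · classical
    let x : Fin n → ℝ := fun j => if G.Reachable i j then 1 else 0
    obtain ⟨j, hkj, hj⟩ := hex x k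
    have hone : x i ≤ x j := (hle x (.refl i)).trans_eq ((h x).trans hj)
    have hij : G.Reachable i j := by
      by_contra hij
      norm_num [x, hij] at hone
    exact hij.trans hkj.symm
  · obtain ⟨j, hj, hij⟩ := hex x i
    exact hij.trans_le (hle x (h.symm.trans hj))
  · obtain ⟨j, hj, hkj⟩ := hex x k
    exact hkj.trans_le (hle x (h.trans hj))
end
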